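/- arXiv:1002.0320 — 2 statements merged into one kernel-verified Lean document; each statement's English description precedes it below -/
import Mathlib

section
/- Let G be a finitely generated group and let F be a proper subgroup of G such that F·N = G for every normal subgroup N of finite index in G. Then there exists a maximal proper subgroup M of G containing F, and every maximal proper subgroup of G containing F has infinite index in G. -/
open scoped Pointwise

/-- Let `G` be a finitely generated group and `F` a proper subgroup such that `F · N = G`
for every normal subgroup `N` of finite index in `G`. Then `F` is contained in some
maximal proper subgroup of `G`, and every maximal proper subgroup of `G` containing `F`
has infinite index in `G`. (A maximal proper subgroup is a coatom in the subgroup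
lattice; a subgroup has infinite index exactly when its index is `0`.) -/
theorem exists_maximal_subgroup_of_infinite_index
    (G : Type*) [Group G] [Group.FG G]
    (F : Subgroup G) (hF : F ≠ ⊤)
    (hdense : ∀ N : Subgroup G, N.Normal → N.index ≠ 0 → (F : Set G) * (N : Set G) = Set.univ) :
    (∃ M : Subgroup G, F ≤ M ∧ IsCoatom M) ∧
      ∀ M : Subgroup G, F ≤ M → IsCoatom M → M.index = 0 := by
  have hco : IsCoatomic (Subgroup G) := by
    refine IsCoatomic.of_isChain_bounded fun c hc hne htop => ?_
    refine ⟨sSup c, fun h => htop ?_, fun x hx => le_sSup hx⟩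
    obtain ⟨S, hS⟩ := (Group.FG.out : (⊤ : Subgroup G).FG)
    have hsub : (S : Set G) ⊆ ⋃ K ∈ c, (K : Set G) := by
      intro x _
      have hx : x ∈ sSup c := by rw [h]; trivial
      rw [Subgroup.mem_sSup_of_directedOn hne hc.directedOn] at hx
      simpa using hx
    have hdir : DirectedOn (fun i j : Subgroup G => (i : Set G) ⊆ (j : Set G)) c :=
      hc.directedOn
    obtain ⟨K, hK, hSK⟩ :=
      hdir.exists_mem_subset_of_finset_subset_biUnion hne hsub
    have hKt : K = ⊤ := by
      rw [eq_top_iff, ← hS, Subgroup.closure_le]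
      exact hSK
    exact hKt ▸ hK
  refine ⟨?_, fun M hFM hM => ?_⟩
  · rcases hco.eq_top_or_exists_le_coatom F with h | ⟨M, hM, hFM⟩
    · exact absurd h hF
    · exact ⟨M, hFM, hM⟩
  · by_contra hi
    haveI : M.FiniteIndex := ⟨hi⟩
    have hd := hdense M.normalCore inferInstance Subgroup.FiniteIndex.index_ne_zero
    apply hM.1
    rw [eq_top_iff]
    intro x _
    have hx : x ∈ (F : Set G) * (M.normalCore : Set G) := by rw [hd]; trivial
    obtain ⟨f, hf, n, hn, rfl⟩ := hx
    exact M.mul_mem (hFM hf) (M.normalCore_le hn)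
end

section
/- Let (A_n), n ≥ 1, be a sequence of finite abelian groups. The profinite group ∏_{n≥1} A_n (with the product topology) is topologically finitely generated if and only if there exists d such that for every prime p, the sum over n of the p-ranks of A_n is at most d, where the p-rank of a finite abelian group A is the dimension of A/pA over the field with p elements. Moreover, in that case, ∏_{n≥1} A_n is topologically generated by d elements where d = sup over primes p of Σ_n rank_p(A_n). -/
/-- The subgroup `p·A` of an additive commutative group `A`, consisting of all
`p`-th multiples. -/
def pMultiples (p : ℕ) (A : Type*) [AddCommGroup A] : AddSubgroup A where
  carrier := {a | ∃ b, p • b = a}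
  zero_mem' := ⟨0, smul_zero p⟩
  add_mem' := by
    rintro a b ⟨a', rfl⟩ ⟨b', rfl⟩
    exact ⟨a' + b', smul_add p a' b'⟩
  neg_mem' := by
    rintro a ⟨a', rfl⟩
    exact ⟨-a', smul_neg p a'⟩

/-- The `p`-rank of an additive commutative group `A`: the dimension of `A / pA` as a
vector space over the field `ZMod p` with `p` elements. -/
noncomputable def pRank (p : ℕ) (A : Type*) [AddCommGroup A] : ℕ :=
  letI : Module (ZMod p) (A ⧸ pMultiples p A) := AddCommGroup.zmodModule (by
    intro x
    induction x using QuotientAddGroup.induction_on with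
    | H a =>
      rw [← QuotientAddGroup.mk_nsmul]
      exact (QuotientAddGroup.eq_zero_iff _).2 ⟨a, rfl⟩)
  Module.finrank (ZMod p) (A ⧸ pMultiples p A)

/-- A topological additive group is topologically generated by at most `d` elements if
some subset of at most `d` elements generates a dense subgroup. -/
def TopologicallyAddGenByLE (d : ℕ) (G : Type*) [AddGroup G] [TopologicalSpace G] : Prop :=
  ∃ S : Finset G, S.card ≤ d ∧
    Dense ((AddSubgroup.closure (S : Set G) : AddSubgroup G) : Set G)

/-- A topological additive group is topologically finitely generated if some finite
subset generates a dense subgroup. -/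
def TopologicallyAddFG (G : Type*) [AddGroup G] [TopologicalSpace G] : Prop :=
  ∃ S : Finset G, Dense ((AddSubgroup.closure (S : Set G) : AddSubgroup G) : Set G)

lemma pRank_eq_of_surj (p : ℕ) {A V : Type*} [AddCommGroup A] [AddCommGroup V]
    [Module (ZMod p) V] (φ : A →+ V) (hs : Function.Surjective φ)
    (hk : φ.ker = pMultiples p A) : pRank p A = Module.finrank (ZMod p) V := by
  unfold pRank
  letI : Module (ZMod p) (A ⧸ pMultiples p A) := AddCommGroup.zmodModule (by
    intro x
    induction x using QuotientAddGroup.induction_on with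
    | H a =>
      rw [← QuotientAddGroup.mk_nsmul]
      exact (QuotientAddGroup.eq_zero_iff _).2 ⟨a, rfl⟩)
  let e : (A ⧸ pMultiples p A) ≃+ V :=
    (QuotientAddGroup.quotientAddEquivOfEq hk.symm).trans
      (QuotientAddGroup.quotientKerEquivOfSurjective φ hs)
  let e' : (A ⧸ pMultiples p A) ≃ₗ[ZMod p] V :=
    { e.toAddMonoidHom.toZModLinearMap p with
      invFun := e.symm
      left_inv := e.left_inv
      right_inv := e.right_inv }
  exact e'.finrank_eq

lemma exists_pRank_quot (p : ℕ) (A : Type*) [AddCommGroup A] :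
    Nonempty (Module (ZMod p) (A ⧸ pMultiples p A)) :=
  ⟨AddCommGroup.zmodModule (by
    intro x
    induction x using QuotientAddGroup.induction_on with
    | H a =>
      rw [← QuotientAddGroup.mk_nsmul]
      exact (QuotientAddGroup.eq_zero_iff _).2 ⟨a, rfl⟩)⟩

lemma pRank_eq_finrank (p : ℕ) (A : Type*) [AddCommGroup A]
    [Module (ZMod p) (A ⧸ pMultiples p A)] :
    pRank p A = Module.finrank (ZMod p) (A ⧸ pMultiples p A) :=
  pRank_eq_of_surj p (QuotientAddGroup.mk' _) (QuotientAddGroup.mk'_surjective _)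
    (QuotientAddGroup.ker_mk' _)

lemma pRank_pi (p : ℕ) [Fact p.Prime] {ι : Type*} [Fintype ι] (A : ι → Type*)
    [∀ i, AddCommGroup (A i)] [∀ i, Finite (A i)] :
    pRank p (∀ i, A i) = ∑ i, pRank p (A i) := by
  letI : ∀ i, Module (ZMod p) (A i ⧸ pMultiples p (A i)) :=
    fun i => (exists_pRank_quot p (A i)).some
  simp_rw [fun i => pRank_eq_finrank p (A i)]
  rw [← Module.finrank_pi_fintype]
  let φ : (∀ i, A i) →+ (∀ i, A i ⧸ pMultiples p (A i)) :=
    { toFun := fun f i => (f i : A i ⧸ pMultiples p (A i))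
      map_zero' := rfl
      map_add' := fun _ _ => rfl }
  refine pRank_eq_of_surj p φ ?_ ?_
  · intro g
    choose f hf using fun i => QuotientAddGroup.mk_surjective (g i)
    exact ⟨f, funext hf⟩
  · ext f
    rw [AddMonoidHom.mem_ker]
    constructor
    · intro h
      have : ∀ i, f i ∈ pMultiples p (A i) := fun i =>
        (QuotientAddGroup.eq_zero_iff _).1 (congrFun h i)
      choose b hb using this
      exact ⟨b, funext hb⟩
    · rintro ⟨b, rfl⟩
      funext i
      exact (QuotientAddGroup.eq_zero_iff _).2 ⟨b i, rfl⟩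

/-- Few generators give small `p`-rank. -/
lemma pRank_le_of_closure (p : ℕ) [Fact p.Prime] (B : Type*) [AddCommGroup B]
    (S : Finset B) (h : AddSubgroup.closure (S : Set B) = ⊤) : pRank p B ≤ S.card := by
  classical
  letI := (exists_pRank_quot p B).some
  rw [pRank_eq_finrank]
  have hsp : Submodule.span (ZMod p)
      ((S.image (QuotientAddGroup.mk' (pMultiples p B)) : Finset _) : Set (B ⧸ pMultiples p B)) = ⊤ := by
    rw [eq_top_iff]
    rintro x -
    obtain ⟨b, rfl⟩ := QuotientAddGroup.mk'_surjective _ x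
    have hb : b ∈ AddSubgroup.closure (S : Set B) := h ▸ AddSubgroup.mem_top b
    have : AddSubgroup.closure (S : Set B) ≤ (Submodule.span (ZMod p)
      ((S.image (QuotientAddGroup.mk' (pMultiples p B)) : Finset _) :
        Set (B ⧸ pMultiples p B))).toAddSubgroup.comap (QuotientAddGroup.mk' (pMultiples p B)) := by
      rw [AddSubgroup.closure_le]
      intro s hs
      exact Submodule.subset_span (Finset.mem_coe.2 (Finset.mem_image_of_mem _ hs))
    exact this hb
  have h1 := finrank_span_finset_le_card (R := ZMod p)
    (S.image (QuotientAddGroup.mk' (pMultiples p B)))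
  rw [Set.finrank, hsp, finrank_top] at h1
  exact h1.trans Finset.card_image_le

/-- Lifts of a spanning family mod `p`. -/
lemma exists_gen_mod (p : ℕ) [Fact p.Prime] (B : Type*) [AddCommGroup B] [Finite B]
    (d : ℕ) (h : pRank p B ≤ d) :
    ∃ f : Fin d → B, AddSubgroup.closure (Set.range f) ⊔ pMultiples p B = ⊤ := by
  letI := (exists_pRank_quot p B).some
  rw [pRank_eq_finrank] at h
  let b := Module.finBasis (ZMod p) (B ⧸ pMultiples p B)
  choose g hg using fun i => QuotientAddGroup.mk'_surjective (pMultiples p B) (b i)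
  refine ⟨fun i => if hi : (i : ℕ) < Module.finrank (ZMod p) (B ⧸ pMultiples p B)
    then g ⟨i, hi⟩ else 0, ?_⟩
  set f : Fin d → B := fun i => if hi : (i : ℕ) < Module.finrank (ZMod p) (B ⧸ pMultiples p B)
    then g ⟨i, hi⟩ else 0 with hf
  have hgmem : ∀ i, g i ∈ AddSubgroup.closure (Set.range f) := fun i =>
    AddSubgroup.subset_closure ⟨⟨i, i.2.trans_le h⟩, by simp [hf]⟩
  rw [eq_top_iff]
  rintro x -
  have hx := b.sum_repr (QuotientAddGroup.mk' (pMultiples p B) x)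
  set y : B := ∑ i, (b.repr (QuotientAddGroup.mk' (pMultiples p B) x) i).val • g i with hy
  have hy1 : y ∈ AddSubgroup.closure (Set.range f) :=
    AddSubgroup.sum_mem _ fun i _ => AddSubgroup.nsmul_mem _ (hgmem i) _
  have hy2 : QuotientAddGroup.mk' (pMultiples p B) y = QuotientAddGroup.mk' (pMultiples p B) x := by
    rw [← hx, hy, map_sum]
    refine Finset.sum_congr rfl fun i _ => ?_
    rw [map_nsmul, hg, ← Nat.cast_smul_eq_nsmul (ZMod p), ZMod.natCast_zmod_val]
  have : -y + x ∈ pMultiples p B := QuotientAddGroup.eq.1 hy2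
  have := AddSubgroup.add_mem_sup hy1 this
  simpa using this

lemma exists_crt (P : Finset ℕ) (hP : ∀ p ∈ P, p.Prime) (p : ℕ) (hp : p ∈ P) :
    ∃ c : ℕ, (∃ k : ℤ, (c : ℤ) = 1 + p * k) ∧ ∀ q ∈ P, q ≠ p → q ∣ c := by
  have hco : Nat.Coprime (∏ q ∈ P.erase p, q) p := by
    refine Nat.Coprime.prod_left fun q hq => ?_
    exact (Nat.coprime_primes (hP q (Finset.mem_of_mem_erase hq)) (hP p hp)).2
      (Finset.ne_of_mem_erase hq)
  obtain ⟨c, h1, h2⟩ := Nat.chineseRemainder hco 0 1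
  refine ⟨c, ?_, ?_⟩
  · have := (Nat.modEq_iff_dvd.1 h2.symm)
    obtain ⟨k, hk⟩ := this
    exact ⟨k, by push_cast at hk; linarith⟩
  · intro q hq hqp
    exact (Finset.dvd_prod_of_mem _ (Finset.mem_erase.2 ⟨hqp, hq⟩)).trans
      ((Nat.modEq_zero_iff_dvd).1 h1)

/-- A finite abelian group all of whose `p`-ranks are at most `d` has `d` generators. -/
lemma exists_gen (B : Type*) [AddCommGroup B] [Finite B]
    (d : ℕ) (h : ∀ p : ℕ, p.Prime → pRank p B ≤ d) :
    ∃ f : Fin d → B, AddSubgroup.closure (Set.range f) = ⊤ := by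
  classical
  set P := (Nat.card B).primeFactors with hPdef
  have hP : ∀ p ∈ P, p.Prime := fun p hp => Nat.prime_of_mem_primeFactors hp
  have h1 : ∀ p : P, ∃ f : Fin d → B,
      AddSubgroup.closure (Set.range f) ⊔ pMultiples (p : ℕ) B = ⊤ := fun p =>
    haveI : Fact (p : ℕ).Prime := ⟨hP p p.2⟩
    exists_gen_mod p B d (h p (hP p p.2))
  choose x hx using h1
  choose c hc1 hc2 using fun p : P => exists_crt P hP p p.2
  let f : Fin d → B := fun i => ∑ p : P, c p • x p i
  refine ⟨f, ?_⟩
  set H := AddSubgroup.closure (Set.range f) with hH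
  have hfx : ∀ (p : P) i, x p i ∈ H ⊔ pMultiples (p : ℕ) B := by
    intro p i
    have hfi : f i ∈ H := AddSubgroup.subset_closure ⟨i, rfl⟩
    have hd : x p i - f i ∈ pMultiples (p : ℕ) B := by
      have e : x p i - f i = (x p i - c p • x p i) - ∑ q ∈ Finset.univ.erase p, c q • x q i := by
        rw [sub_sub, Finset.add_sum_erase _ (fun q => c q • x q i) (Finset.mem_univ p)]
      rw [e]
      refine AddSubgroup.sub_mem _ ?_ (AddSubgroup.sum_mem _ fun q hq => ?_)
      · obtain ⟨k, hk⟩ := hc1 p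
        refine ⟨-(k • x p i), ?_⟩
        rw [← natCast_zsmul, ← natCast_zsmul, hk]
        module
      · obtain ⟨m, hm⟩ := hc2 q p p.2 (fun h => (Finset.ne_of_mem_erase hq) (Subtype.ext h.symm))
        exact ⟨m • x q i, by rw [hm, mul_smul]⟩
    have := AddSubgroup.add_mem_sup hfi hd
    simpa using this
  have hsup : ∀ p : P, H ⊔ pMultiples (p : ℕ) B = ⊤ := by
    intro p
    rw [eq_top_iff, ← hx p]
    refine sup_le ?_ le_sup_right
    rw [AddSubgroup.closure_le]
    rintro _ ⟨i, rfl⟩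
    exact hfx p i
  -- the quotient is trivial
  rw [← AddSubgroup.index_eq_one]
  by_contra hne
  obtain ⟨p, hp, hpd⟩ := Nat.exists_prime_and_dvd hne
  haveI : Fact p.Prime := ⟨hp⟩
  have hpP : p ∈ P := Nat.mem_primeFactors.2
    ⟨hp, hpd.trans H.index_dvd_card, Nat.card_pos.ne'⟩
  have hsurj : Function.Surjective (fun z : B ⧸ H => p • z) := by
    intro z
    obtain ⟨b, rfl⟩ := QuotientAddGroup.mk_surjective z
    have hb : b ∈ H ⊔ pMultiples p B := (hsup ⟨p, hpP⟩).symm ▸ AddSubgroup.mem_top b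
    obtain ⟨y, hy, _, ⟨w, rfl⟩, rfl⟩ := AddSubgroup.mem_sup.1 hb
    refine ⟨(w : B ⧸ H), ?_⟩
    rw [QuotientAddGroup.mk_add, (QuotientAddGroup.eq_zero_iff y).2 hy, zero_add]
    rfl
  have hinj := Finite.injective_iff_surjective.2 hsurj
  obtain ⟨z, hz⟩ := exists_prime_addOrderOf_dvd_card' (G := B ⧸ H) p hpd
  have hz0 : z = 0 := hinj (by
    change p • z = p • 0
    rw [smul_zero, ← hz, addOrderOf_nsmul_eq_zero])
  rw [hz0, addOrderOf_zero] at hz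
  exact hp.one_lt.ne hz

section top
variable (A : ℕ → Type) [∀ n, AddCommGroup (A n)]

/-- Restriction to finitely many coordinates. -/
def resHom (s : Finset ℕ) : (∀ n, A n) →+ (∀ n : s, A n) where
  toFun f n := f n
  map_zero' := rfl
  map_add' _ _ := rfl

lemma resHom_surjective (s : Finset ℕ) : Function.Surjective (resHom A s) := by
  classical
  intro g
  exact ⟨fun n => if h : n ∈ s then g ⟨n, h⟩ else 0, by funext n; simp [resHom]⟩

variable [∀ n, TopologicalSpace (A n)]

lemma resHom_continuous (s : Finset ℕ) : Continuous (resHom A s) :=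
  continuous_pi fun n => continuous_apply (n : ℕ)

variable [∀ n, DiscreteTopology (A n)]

lemma dense_iff_map (H : AddSubgroup (∀ n, A n)) :
    Dense (H : Set (∀ n, A n)) ↔ ∀ s, H.map (resHom A s) = ⊤ := by
  constructor
  · intro h s
    have h1 : Dense (resHom A s '' H) :=
      (resHom_surjective A s).denseRange.dense_image (resHom_continuous A s) h
    rw [dense_discrete] at h1
    exact SetLike.coe_injective (by simpa using h1)
  · intro h
    rw [dense_iff_inter_open]
    rintro U hU ⟨x, hx⟩
    obtain ⟨s, u, hu, hsub⟩ := isOpen_pi_iff.1 hU x hx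
    have : resHom A s x ∈ H.map (resHom A s) := h s ▸ AddSubgroup.mem_top _
    obtain ⟨y, hy, hyx⟩ := this
    refine ⟨y, hsub fun n hn => ?_, hy⟩
    have : y n = x n := congrFun hyx ⟨n, hn⟩
    rw [this]
    exact (hu n hn).2

lemma exists_dense_gen [∀ n, Finite (A n)] (d : ℕ)
    (h : ∀ p : ℕ, p.Prime → ∀ s : Finset ℕ, ∑ n ∈ s, pRank p (A n) ≤ d) :
    TopologicallyAddGenByLE d (∀ n, A n) := by
  classical
  let C : Finset ℕ → Set (Fin d → ∀ n, A n) := fun s =>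
    {f | AddSubgroup.closure (Set.range (fun i => resHom A s (f i))) = ⊤}
  have hmap : ∀ s (f : Fin d → ∀ n, A n), (AddSubgroup.closure (Set.range f)).map (resHom A s) =
      AddSubgroup.closure (Set.range (fun i => resHom A s (f i))) := by
    intro s f
    rw [AddMonoidHom.map_closure, ← Set.range_comp]
    rfl
  have hanti : Antitone C := by
    intro s t hst f hf
    change _ = _ at hf
    change _ = _
    rw [← hmap] at hf ⊢
    rw [eq_top_iff]
    rintro g -
    obtain ⟨x, rfl⟩ := resHom_surjective A s g
    have : resHom A t x ∈ (AddSubgroup.closure (Set.range f)).map (resHom A t) :=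
      hf ▸ AddSubgroup.mem_top _
    obtain ⟨y, hy, hyx⟩ := this
    exact ⟨y, hy, funext fun n => congrFun hyx ⟨n, hst n.2⟩⟩
  have hclosed : ∀ s, IsClosed (C s) := by
    intro s
    have hc : Continuous (fun (f : Fin d → ∀ n, A n) i => resHom A s (f i)) :=
      continuous_pi fun i => (resHom_continuous A s).comp (continuous_apply i)
    exact (isClosed_discrete {g : Fin d → ∀ n : s, A n |
      AddSubgroup.closure (Set.range g) = ⊤}).preimage hc
  have hne : ∀ s, (C s).Nonempty := by
    intro s
    obtain ⟨g, hg⟩ := exists_gen (∀ n : s, A n) d (fun p hp => by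
      haveI : Fact p.Prime := ⟨hp⟩
      rw [pRank_pi, Finset.sum_coe_sort s (fun n => pRank p (A n))]
      exact h p hp s)
    choose f hf using fun i => resHom_surjective A s (g i)
    refine ⟨f, ?_⟩
    change _ = _
    simp_rw [hf]
    exact hg
  obtain ⟨f, hf⟩ := IsCompact.nonempty_iInter_of_directed_nonempty_isCompact_isClosed C
    (directed_of_isDirected_le hanti) hne (fun s => (hclosed s).isCompact) hclosed
  refine ⟨Finset.univ.image f, Finset.card_image_le.trans (by simp), ?_⟩
  rw [Finset.coe_image, Finset.coe_univ, Set.image_univ, dense_iff_map]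
  intro s
  rw [hmap]
  exact Set.mem_iInter.1 hf s

end top

/-- Let `(A n)` be a sequence of finite abelian groups (each with the discrete topology).
The profinite group `∏ n, A n` with the product topology is topologically finitely
generated if and only if there is a `d` such that for every prime `p` the sum over `n`
of the `p`-ranks of the `A n` (i.e. every finite partial sum) is at most `d`; moreover,
in that case `∏ n, A n` is topologically generated by `d` elements for any such bound
`d` — in particular for `d = sup_p ∑ n, pRank p (A n)`. -/
theorem prod_abelian_topFG_iff_pRank_bounded
    (A : ℕ → Type) [∀ n, AddCommGroup (A n)] [∀ n, Finite (A n)]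
    [∀ n, TopologicalSpace (A n)] [∀ n, DiscreteTopology (A n)] :
    (TopologicallyAddFG (∀ n, A n) ↔
      ∃ d : ℕ, ∀ p : ℕ, p.Prime → ∀ s : Finset ℕ, ∑ n ∈ s, pRank p (A n) ≤ d) ∧
    ∀ d : ℕ, (∀ p : ℕ, p.Prime → ∀ s : Finset ℕ, ∑ n ∈ s, pRank p (A n) ≤ d) →
      TopologicallyAddGenByLE d (∀ n, A n) := by
  classical
  refine ⟨⟨?_, ?_⟩, fun d h => exists_dense_gen A d h⟩
  · rintro ⟨S, hS⟩
    refine ⟨S.card, fun p hp s => ?_⟩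
    haveI : Fact p.Prime := ⟨hp⟩
    rw [dense_iff_map] at hS
    have h1 := hS s
    rw [AddMonoidHom.map_closure, ← Finset.coe_image] at h1
    have h2 := pRank_le_of_closure p _ _ h1
    rw [pRank_pi, Finset.sum_coe_sort s (fun n => pRank p (A n))] at h2
    exact h2.trans Finset.card_image_le
  · rintro ⟨d, h⟩
    obtain ⟨S, -, hS⟩ := exists_dense_gen A d h
    exact ⟨S, hS⟩
end
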